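/- arXiv:0807.1174 — 2 statements merged into one kernel-verified Lean document; each statement's English description precedes it below -/
import Mathlib

section
/- Let p be a prime and let K be a finite extension of ℚ_p containing a primitive p^m-th root of unity, where m ≥ 1. If α is a p-primary unit of K (i.e., α ∈ O_K^× and the extension K(α^{1/p})/K obtained by adjoining a p-th root of α is unramified), then the norm N_{K/ℚ_p}(α) is congruent to 1 modulo p^{m+1}. -/
set_option synthInstance.maxHeartbeats 1000000
set_option maxHeartbeats 1000000
noncomputable section

namespace PadicStmt

variable (p : ℕ) [Fact p.Prime]

/-- The `ℤ_[p]`-algebra structure on a `ℚ_[p]`-algebra. -/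
noncomputable instance zpAlgebra (K : Type) [Field K] [Algebra ℚ_[p] K] :
    Algebra ℤ_[p] K :=
  ((algebraMap ℚ_[p] K).comp (algebraMap ℤ_[p] ℚ_[p])).toAlgebra

instance zpTower (K : Type) [Field K] [Algebra ℚ_[p] K] :
    IsScalarTower ℤ_[p] ℚ_[p] K :=
  IsScalarTower.of_algebraMap_eq fun _ => rfl

instance zpTower' (K L : Type) [Field K] [Field L] [Algebra ℚ_[p] K] [Algebra ℚ_[p] L]
    [Algebra K L] [IsScalarTower ℚ_[p] K L] : IsScalarTower ℤ_[p] K L :=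
  IsScalarTower.of_algebraMap_eq fun x => by
    rw [IsScalarTower.algebraMap_apply ℤ_[p] ℚ_[p] L, IsScalarTower.algebraMap_apply ℚ_[p] K L,
      IsScalarTower.algebraMap_apply ℤ_[p] ℚ_[p] K]

/-- The ring of integers of a `p`-adic field `K`, i.e. the integral closure of `ℤ_[p]` in `K`. -/
abbrev O (K : Type) [Field K] [Algebra ℚ_[p] K] := integralClosure ℤ_[p] K

/-- The natural map `O_K → O_L` for an extension `L/K` of `p`-adic fields. -/
def intMap (K L : Type) [Field K] [Field L] [Algebra ℚ_[p] K] [Algebra ℚ_[p] L]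
    [Algebra K L] [IsScalarTower ℚ_[p] K L] : O p K →+* O p L where
  toFun x := ⟨algebraMap K L x.1, IsIntegral.map (IsScalarTower.toAlgHom ℤ_[p] K L) x.2⟩
  map_one' := Subtype.ext (map_one _)
  map_mul' x y := Subtype.ext (map_mul _ _ _)
  map_zero' := Subtype.ext (map_zero _)
  map_add' x y := Subtype.ext (map_add _ _ _)

/-- The maximal ideal of the ring of integers of a `p`-adic field, described as the
Jacobson radical of `⊥`. -/
def maxIdeal (K : Type) [Field K] [Algebra ℚ_[p] K] : Ideal (O p K) :=
  (⊥ : Ideal (O p K)).jacobson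

/-- `v_K x ≥ n`:  `x` is integral and lies in the `n`-th power of the maximal ideal. -/
def ValGE (K : Type) [Field K] [Algebra ℚ_[p] K] (n : ℕ) (x : K) : Prop :=
  ∃ y : O p K, (y : K) = x ∧ y ∈ (maxIdeal p K) ^ n

/-- `x : K` is a unit of the ring of integers `O_K`. -/
def IsIntegralUnit (K : Type) [Field K] [Algebra ℚ_[p] K] (x : K) : Prop :=
  ∃ u : (O p K)ˣ, ((u : O p K) : K) = x

/-- `x ∈ U_{n,K}`, the `n`-th unit group: `x` is a unit of `O_K` and `v_K (1 - x) ≥ n`. -/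
def InU (K : Type) [Field K] [Algebra ℚ_[p] K] (n : ℕ) (x : K) : Prop :=
  IsIntegralUnit p K x ∧ ValGE p K n (1 - x)

/-- An extension `L/K` of `p`-adic fields is unramified iff `m_K O_L = m_L`
(i.e. the ramification index is `1`; the residue extension is automatically separable). -/
def IsUnramifiedExt (K L : Type) [Field K] [Field L] [Algebra ℚ_[p] K] [Algebra ℚ_[p] L]
    [Algebra K L] [IsScalarTower ℚ_[p] K L] : Prop :=
  Ideal.map (intMap p K L) (maxIdeal p K) = maxIdeal p L

/-- An extension `L/K` of `p`-adic fields is totally ramified iff its residue degree is `1`,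
i.e. `O_L = O_K + m_L`. -/
def IsTotallyRamifiedExt (K L : Type) [Field K] [Field L] [Algebra ℚ_[p] K] [Algebra ℚ_[p] L]
    [Algebra K L] [IsScalarTower ℚ_[p] K L] : Prop :=
  ∀ x : O p L, ∃ y : O p K, x - intMap p K L y ∈ maxIdeal p L

/-- A witness that `α : K` acquires an `n`-th root in some unramified extension of `K`. -/
structure UnramifiedRootWitness (K : Type) [Field K] [Algebra ℚ_[p] K] (n : ℕ) (α : K) where
  L : Type
  [fieldL : Field L]
  [algQL : Algebra ℚ_[p] L]
  [algKL : Algebra K L]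
  [tower : IsScalarTower ℚ_[p] K L]
  [fin : FiniteDimensional ℚ_[p] L]
  β : L
  pow_eq : β ^ n = algebraMap K L α
  unram : IsUnramifiedExt p K L

/-- A unit `α` of `O_K` is `p`-primary if `K(α^{1/p})/K` is unramified, equivalently `α`
admits a `p`-th root in an unramified extension of `K`. -/
def IsPPrimary (K : Type) [Field K] [Algebra ℚ_[p] K] (α : K) : Prop :=
  IsIntegralUnit p K α ∧ Nonempty (UnramifiedRootWitness p K p α)

end PadicStmt

namespace PadicStmt

open Polynomial Finset

variable {p : ℕ} [hp : Fact p.Prime]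

lemma norm_algebraMap_padicInt (a : ℤ_[p]) : ‖algebraMap ℤ_[p] (PadicAlgCl p) a‖ = ‖a‖ :=
  PadicAlgCl.norm_extends p (a : ℚ_[p])

lemma norm_natCast_padicAlgCl (n : ℕ) : ‖(n : PadicAlgCl p)‖ = ‖(n : ℚ_[p])‖ := by
  rw [← PadicAlgCl.norm_extends p (n : ℚ_[p])]; simp

lemma norm_algHom {K : Type} [Field K] [Algebra ℚ_[p] K] (ι : K →ₐ[ℚ_[p]] PadicAlgCl p) (x : K) :
    ‖ι x‖ = spectralNorm ℚ_[p] K x := by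
  rw [← PadicAlgCl.spectralNorm_eq, spectralNorm, spectralNorm,
    minpoly.algHom_eq ι ι.injective]

/-- An element of a `p`-adic field is integral iff its norm is at most one. -/
lemma isIntegral_iff_norm_le_one {K : Type} [Field K] [Algebra ℚ_[p] K]
    (ι : K →ₐ[ℚ_[p]] PadicAlgCl p) (x : K) : IsIntegral ℤ_[p] x ↔ ‖ι x‖ ≤ 1 := by
  have hx : IsIntegral ℚ_[p] x := by
    rw [← isIntegral_algHom_iff ι ι.injective]
    exact Algebra.IsIntegral.isIntegral _
  rw [norm_algHom, spectralNorm, spectralValue_le_one_iff (minpoly.monic hx)]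
  constructor
  · intro h n
    rw [minpoly.isIntegrallyClosed_eq_field_fractions' ℚ_[p] h, coeff_map]
    exact PadicInt.norm_le_one _
  · intro h
    have hl : minpoly ℚ_[p] x ∈ lifts (algebraMap ℤ_[p] ℚ_[p]) := by
      rw [lifts_iff_coeff_lifts]
      intro n
      exact ⟨⟨_, h n⟩, rfl⟩
    obtain ⟨q, hq, -, hm⟩ := lifts_and_natDegree_eq_and_monic hl (minpoly.monic hx)
    refine ⟨q, hm, ?_⟩
    rw [← aeval_def, ← aeval_map_algebraMap ℚ_[p], hq, minpoly.aeval]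

lemma norm_le_one_of_isIntegral {x : PadicAlgCl p} (h : IsIntegral ℤ_[p] x) : ‖x‖ ≤ 1 :=
  (isIntegral_iff_norm_le_one (AlgHom.id ℚ_[p] _) x).1 h

lemma isIntegral_of_norm_le_one {x : PadicAlgCl p} (h : ‖x‖ ≤ 1) : IsIntegral ℤ_[p] x :=
  (isIntegral_iff_norm_le_one (AlgHom.id ℚ_[p] _) x).2 h

lemma norm_aeval_le_one (g : ℤ_[p][X]) {x : PadicAlgCl p} (hx : ‖x‖ ≤ 1) :
    ‖aeval x g‖ ≤ 1 :=
  norm_le_one_of_isIntegral <| by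
    have := isIntegral_of_norm_le_one hx
    exact (adjoin_le_integralClosure this) (aeval_mem_adjoin_singleton _ _)

lemma norm_sum_le_of_forall {σ : Type*} (s : Finset σ) (f : σ → PadicAlgCl p) {C : ℝ} (hC : 0 ≤ C)
    (h : ∀ i ∈ s, ‖f i‖ ≤ C) : ‖∑ i ∈ s, f i‖ ≤ C :=
  IsUltrametricDist.norm_sum_le_of_forall_le_of_nonneg hC h

lemma norm_p_pow_le_norm_natCast (j : ℕ) (hj : j ≠ 0) :
    ‖(p : PadicAlgCl p)‖ ^ (j - 1) ≤ ‖(j : PadicAlgCl p)‖ := by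
  rw [norm_natCast_padicAlgCl, norm_natCast_padicAlgCl, ← norm_pow, Padic.norm_p_pow]
  have h : ((p : ℚ_[p]) ^ (padicValNat p j)) = ((p ^ padicValNat p j : ℕ) : ℚ_[p]) := by simp
  rw [Padic.norm_eq_zpow_neg_valuation (by exact_mod_cast hj), Padic.valuation_natCast]
  refine zpow_le_zpow_right₀ (by exact_mod_cast hp.out.one_le) ?_
  have h1 : padicValNat p j ≤ Nat.log p j := padicValNat_le_nat_log j
  have h2 : Nat.log p j < j := Nat.log_lt_self p hj
  omega

/-- If the power sums of integral elements `z i` are divisible by `n`, then the product of the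
`1 + p z i` is congruent to `1` modulo `p n`. -/
lemma norm_prod_one_add_sub_one_le {σ : Type*} [Fintype σ] (z : σ → PadicAlgCl p)
    (hz : ∀ i, ‖z i‖ ≤ 1) (C : ℝ) (h : ∀ j, j ≠ 0 → ‖∑ i, z i ^ j‖ ≤ C) :
    ‖∏ i, (1 + p * z i) - 1‖ ≤ ‖(p : PadicAlgCl p)‖ * C := by
  classical
  have hC : 0 ≤ C := (norm_nonneg _).trans (h 1 one_ne_zero)
  set e : ℕ → PadicAlgCl p := fun j => ∑ t ∈ powersetCard j univ, ∏ i ∈ t, z i with he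
  have haev (j : ℕ) : MvPolynomial.aeval z (MvPolynomial.esymm σ ℤ j) = e j := by
    simp [MvPolynomial.esymm, he]
  have he1 (j : ℕ) : ‖e j‖ ≤ 1 := by
    refine norm_sum_le_of_forall _ _ zero_le_one fun t _ => ?_
    rw [norm_prod]
    exact Finset.prod_le_one (fun _ _ => norm_nonneg _) fun i _ => hz i
  have hje (j : ℕ) : ‖(j : PadicAlgCl p) * e j‖ ≤ C := by
    have := congrArg (MvPolynomial.aeval z) (MvPolynomial.mul_esymm_eq_sum σ ℤ j)
    simp only [map_mul, map_natCast, haev, map_sum, map_pow, map_neg, map_one] at this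
    rw [this, norm_mul, norm_pow, norm_neg, norm_one, one_pow, one_mul]
    refine norm_sum_le_of_forall _ _ hC fun a ha => ?_
    rw [Finset.mem_filter, HasAntidiagonal.mem_antidiagonal] at ha
    rw [norm_mul, norm_mul, norm_pow, norm_neg, norm_one, one_pow, one_mul]
    have h2 : ‖MvPolynomial.aeval z (MvPolynomial.psum σ ℤ a.2)‖ ≤ C := by
      simpa [MvPolynomial.psum] using h a.2 (by omega)
    calc _ ≤ 1 * C := mul_le_mul (he1 _) h2 (norm_nonneg _) zero_le_one
      _ = C := one_mul C
  have hexp : ∏ i, (1 + p * z i) - 1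
      = ∑ j ∈ range (Fintype.card σ), (p : PadicAlgCl p) ^ (j + 1) * e (j + 1) := by
    rw [Finset.prod_one_add, Finset.sum_powerset, Finset.sum_range_succ', Finset.card_univ]
    simp only [powersetCard_zero, sum_singleton, prod_empty, add_sub_cancel_right]
    refine Finset.sum_congr rfl fun j _ => ?_
    rw [he, Finset.mul_sum]
    refine Finset.sum_congr rfl fun t ht => ?_
    rw [Finset.prod_mul_distrib, Finset.prod_const, (Finset.mem_powersetCard.1 ht).2]
  rw [hexp]
  refine norm_sum_le_of_forall _ _ (by positivity) fun j _ => ?_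
  have h1 := norm_p_pow_le_norm_natCast (p := p) (j + 1) (by omega)
  rw [Nat.add_sub_cancel] at h1
  calc ‖(p : PadicAlgCl p) ^ (j + 1) * e (j + 1)‖
      = ‖(p : PadicAlgCl p)‖ * (‖(p : PadicAlgCl p)‖ ^ j * ‖e (j + 1)‖) := by
        rw [norm_mul, norm_pow]; ring
    _ ≤ ‖(p : PadicAlgCl p)‖ * (‖((j + 1 : ℕ) : PadicAlgCl p)‖ * ‖e (j + 1)‖) := by gcongr
    _ ≤ ‖(p : PadicAlgCl p)‖ * C := by
        rw [← norm_mul]; gcongr; exact hje _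

lemma norm_le_one_of_mem_nthRootsFinset {n : ℕ} (hn : 0 < n) {η : PadicAlgCl p}
    (hη : η ∈ nthRootsFinset n 1) : ‖η‖ ≤ 1 := by
  rw [mem_nthRootsFinset hn] at hη
  have : ‖η‖ ^ n = 1 := by rw [← norm_pow, hη, norm_one]
  exact ((pow_eq_one_iff_of_nonneg (norm_nonneg _) hn.ne').1 this).le

lemma norm_sum_nthRoots_pow_le {n : ℕ} (hn : 0 < n) (j : ℕ) :
    ‖∑ η ∈ nthRootsFinset n (1 : PadicAlgCl p), η ^ j‖ ≤ ‖(n : PadicAlgCl p)‖ := by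
  have : NeZero (n : PadicAlgCl p) := ⟨by exact_mod_cast hn.ne'⟩
  have : NeZero n := ⟨hn.ne'⟩
  obtain ⟨ε, hε⟩ := HasEnoughRootsOfUnity.exists_primitiveRoot (PadicAlgCl p) n
  by_cases h1 : ε ^ j = 1
  · have (η) (hη : η ∈ nthRootsFinset n (1 : PadicAlgCl p)) : η ^ j = 1 := by
      rw [mem_nthRootsFinset hn] at hη
      obtain ⟨i, -, rfl⟩ := hε.eq_pow_of_pow_eq_one hη
      rw [← pow_mul, mul_comm, pow_mul, h1, one_pow]
    rw [Finset.sum_congr rfl this, Finset.sum_const, hε.card_nthRootsFinset]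
    simp
  · have hS : ε ^ j * ∑ η ∈ nthRootsFinset n (1 : PadicAlgCl p), η ^ j
        = ∑ η ∈ nthRootsFinset n (1 : PadicAlgCl p), η ^ j := by
      rw [Finset.mul_sum]
      refine Finset.sum_bij' (fun η _ => ε * η) (fun η _ => ε⁻¹ * η) ?_ ?_ ?_ ?_ ?_
      · intro η hη
        rw [mem_nthRootsFinset hn] at hη ⊢
        rw [mul_pow, hη, hε.pow_eq_one, one_mul]
      · intro η hη
        rw [mem_nthRootsFinset hn] at hη ⊢
        rw [mul_pow, hη, inv_pow, hε.pow_eq_one, inv_one, one_mul]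
      · intro η _; simp [hε.ne_zero hn.ne']
      · intro η _; simp [hε.ne_zero hn.ne']
      · intro η _; rw [mul_pow]
    have : (ε ^ j - 1) * ∑ η ∈ nthRootsFinset n (1 : PadicAlgCl p), η ^ j = 0 := by
      rw [sub_mul, hS, one_mul, sub_self]
    rw [(mul_eq_zero.1 this).resolve_left (sub_ne_zero.2 h1), norm_zero]
    exact norm_nonneg _

lemma norm_sum_nthRoots_aeval_le {n : ℕ} (hn : 0 < n) (g : ℤ_[p][X]) :
    ‖∑ η ∈ nthRootsFinset n (1 : PadicAlgCl p), aeval η g‖ ≤ ‖(n : PadicAlgCl p)‖ := by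
  simp_rw [aeval_eq_sum_range]
  rw [Finset.sum_comm]
  refine norm_sum_le_of_forall _ _ (norm_nonneg _) fun j _ => ?_
  rw [← Finset.smul_sum, Algebra.smul_def, norm_mul, norm_algebraMap_padicInt]
  exact (mul_le_mul (PadicInt.norm_le_one _) (norm_sum_nthRoots_pow_le hn j) (norm_nonneg _)
    zero_le_one).trans_eq (one_mul _)

/-- The norm from `ℤ_p[X]/(X ^ n - 1)` of `1 + p g` is congruent to `1` modulo `p n`. -/
lemma norm_prod_nthRoots_one_add_sub_one_le {n : ℕ} (hn : 0 < n) (g : ℤ_[p][X]) :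
    ‖∏ η ∈ nthRootsFinset n (1 : PadicAlgCl p), (1 + p * aeval η g) - 1‖
      ≤ ‖(p : PadicAlgCl p)‖ * ‖(n : PadicAlgCl p)‖ := by
  rw [← Finset.prod_coe_sort]
  refine norm_prod_one_add_sub_one_le
    (fun η : nthRootsFinset n (1 : PadicAlgCl p) => aeval (η : PadicAlgCl p) g)
    (fun η => norm_aeval_le_one g (norm_le_one_of_mem_nthRootsFinset hn η.2)) _ fun j _ => ?_
  have := norm_sum_nthRoots_aeval_le hn (g ^ j)
  simp_rw [map_pow] at this
  rwa [← Finset.sum_coe_sort] at this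

/-- A polynomial over `ℤ_p` whose value at `1` is a unit is invertible modulo `X ^ p ^ m - 1`. -/
lemma isCoprime_X_pow_sub_one (m : ℕ) {f : ℤ_[p][X]} (hf : IsUnit (f.eval 1)) :
    IsCoprime f (X ^ p ^ m - 1) := by
  rw [← Ideal.isCoprime_span_singleton_iff, Ideal.isCoprime_iff_sup_eq]
  by_contra hne
  obtain ⟨M, hM, hle⟩ := Ideal.exists_le_maximal _ hne
  rw [sup_le_iff, Ideal.span_singleton_le_iff_mem, Ideal.span_singleton_le_iff_mem] at hle
  obtain ⟨hfM, hXM⟩ := hle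
  have hint : Algebra.IsIntegral ℤ_[p] (ℤ_[p][X] ⧸ M) := by
    have hX : IsIntegral ℤ_[p] (Ideal.Quotient.mk M X) := by
      refine ⟨X ^ p ^ m - 1, monic_X_pow_sub_C 1 (pow_ne_zero m hp.out.ne_zero), ?_⟩
      rw [← aeval_def, map_sub, map_pow, aeval_X, map_one, ← map_pow,
        ← map_one (Ideal.Quotient.mk M), ← map_sub]
      exact Ideal.Quotient.eq_zero_iff_mem.2 hXM
    refine ⟨fun y => ?_⟩
    obtain ⟨g, rfl⟩ := Ideal.Quotient.mk_surjective y
    have : Ideal.Quotient.mk M g = aeval (Ideal.Quotient.mk M X) g := by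
      have h := aeval_algHom_apply (Ideal.Quotient.mkₐ ℤ_[p] M) X g
      rw [aeval_X_left_apply] at h
      exact h.symm
    rw [this]
    exact (adjoin_le_integralClosure hX) (aeval_mem_adjoin_singleton _ _)
  have hpM : C (p : ℤ_[p]) ∈ M := by
    let _ := Ideal.Quotient.field M
    have hmax : ((⊥ : Ideal (ℤ_[p][X] ⧸ M)).comap (algebraMap ℤ_[p] (ℤ_[p][X] ⧸ M))).IsMaximal :=
      Ideal.isMaximal_comap_of_isIntegral_of_isMaximal _
    have h := IsLocalRing.eq_maximalIdeal hmax
    have hp' : (p : ℤ_[p]) ∈ IsLocalRing.maximalIdeal ℤ_[p] := by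
      rw [PadicInt.maximalIdeal_eq_span_p]
      exact Ideal.mem_span_singleton_self _
    rw [← h, Ideal.mem_comap, Ideal.mem_bot] at hp'
    exact Ideal.Quotient.eq_zero_iff_mem.1 hp'
  have hX1 : (X - 1 : ℤ_[p][X]) ∈ M := by
    have hchar : CharP (ℤ_[p][X] ⧸ M) p := by
      refine (CharP.charP_iff_prime_eq_zero hp.out).2 ?_
      have := Ideal.Quotient.eq_zero_iff_mem.2 hpM
      simpa using this
    have h := Ideal.Quotient.eq_zero_iff_mem.2 hXM
    rw [map_sub, map_pow, map_one, ← one_pow (p ^ m), ← sub_pow_char_pow] at h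
    have h0 := eq_zero_of_pow_eq_zero h
    rw [← map_one (Ideal.Quotient.mk M), ← map_sub] at h0
    exact Ideal.Quotient.eq_zero_iff_mem.1 h0
  have hC : C (f.eval 1) ∈ M := by
    have hd : X - 1 ∣ f - C (f.eval 1) := by
      rw [← C_1]
      exact X_sub_C_dvd_sub_C_eval
    have := M.sub_mem hfM (M.mem_of_dvd hd hX1)
    rwa [sub_sub_cancel] at this
  exact hM.ne_top (Ideal.eq_top_of_isUnit_mem _ hC (hf.map C))

lemma exists_pow_eq_expand_add (f : ℤ_[p][X]) :
    ∃ h : ℤ_[p][X], f ^ p = expand ℤ_[p] p f + C (p : ℤ_[p]) * h := by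
  suffices C (p : ℤ_[p]) ∣ f ^ p - expand ℤ_[p] p f by
    obtain ⟨h, hh⟩ := this
    exact ⟨h, by rw [← hh]; ring⟩
  rw [C_dvd_iff_dvd_coeff]
  intro i
  have h : (f ^ p - expand ℤ_[p] p f).map (PadicInt.toZMod (p := p)) = 0 := by
    rw [Polynomial.map_sub, Polynomial.map_pow, map_expand, ZMod.expand_card, sub_self]
  rw [← Ideal.mem_span_singleton, ← PadicInt.maximalIdeal_eq_span_p, ← PadicInt.ker_toZMod,
    RingHom.mem_ker, ← coeff_map, h, coeff_zero]

lemma prod_nthRoots_comp_pow (m : ℕ) (φ : PadicAlgCl p → PadicAlgCl p) :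
    ∏ η ∈ nthRootsFinset (p ^ (m + 1)) (1 : PadicAlgCl p), φ (η ^ p)
      = (∏ η ∈ nthRootsFinset (p ^ m) (1 : PadicAlgCl p), φ η) ^ p := by
  classical
  have hpos (k : ℕ) : 0 < p ^ k := pow_pos hp.out.pos k
  have hmaps : ∀ η ∈ nthRootsFinset (p ^ (m + 1)) (1 : PadicAlgCl p),
      η ^ p ∈ nthRootsFinset (p ^ m) (1 : PadicAlgCl p) := by
    intro η hη
    rw [mem_nthRootsFinset (hpos _)] at hη ⊢
    rw [← pow_mul, ← hη, pow_succ']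
  rw [← Finset.prod_fiberwise_of_maps_to hmaps, ← Finset.prod_pow]
  refine Finset.prod_congr rfl fun ξ hξ => ?_
  rw [mem_nthRootsFinset (hpos _)] at hξ
  have hset : {η ∈ nthRootsFinset (p ^ (m + 1)) (1 : PadicAlgCl p) | η ^ p = ξ}
      = nthRootsFinset p ξ := by
    ext η
    rw [Finset.mem_filter, mem_nthRootsFinset (hpos _), mem_nthRootsFinset hp.out.pos]
    refine ⟨fun h => h.2, fun h => ⟨?_, h⟩⟩
    rw [pow_succ', pow_mul, h, hξ]
  have hcard : (nthRootsFinset p ξ).card = p := by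
    have : NeZero (p : PadicAlgCl p) := ⟨by exact_mod_cast hp.out.ne_zero⟩
    have : NeZero p := ⟨hp.out.ne_zero⟩
    obtain ⟨ε, hε⟩ := HasEnoughRootsOfUnity.exists_primitiveRoot (PadicAlgCl p) p
    have hξ0 : ξ ≠ 0 := by
      rintro rfl
      rw [zero_pow (hpos m).ne'] at hξ
      exact zero_ne_one hξ
    rw [nthRootsFinset_def, Multiset.toFinset_card_of_nodup (hε.nthRoots_nodup hξ0),
      hε.card_nthRoots, if_pos (IsAlgClosed.exists_pow_nat_eq ξ hp.out.pos)]
  rw [Finset.prod_congr rfl (g := fun _ => φ ξ), Finset.prod_const, hset, hcard]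
  intro η hη
  rw [(Finset.mem_filter.1 hη).2]

lemma prod_nthRoots_eq_mul (m : ℕ) (φ : PadicAlgCl p → PadicAlgCl p) :
    ∏ η ∈ nthRootsFinset (p ^ (m + 1)) (1 : PadicAlgCl p), φ η
      = (∏ η ∈ primitiveRoots (p ^ (m + 1)) (PadicAlgCl p), φ η) *
        ∏ η ∈ nthRootsFinset (p ^ m) (1 : PadicAlgCl p), φ η := by
  classical
  have hpos (k : ℕ) : 0 < p ^ k := pow_pos hp.out.pos k
  rw [← Finset.prod_union]
  · refine Finset.prod_congr ?_ fun _ _ => rfl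
    ext η
    rw [Finset.mem_union, mem_nthRootsFinset (hpos _), mem_nthRootsFinset (hpos _),
      mem_primitiveRoots (hpos _)]
    constructor
    · intro h
      by_cases h1 : η ^ p ^ m = 1
      · exact Or.inr h1
      · left
        rw [← orderOf_eq_prime_pow h1 h]
        exact IsPrimitiveRoot.orderOf η
    · rintro (h | h)
      · exact h.pow_eq_one
      · rw [pow_succ, pow_mul, h, one_pow]
  · rw [Finset.disjoint_left]
    intro η h1 h2
    rw [mem_nthRootsFinset (hpos _)] at h2
    rw [mem_primitiveRoots (hpos _)] at h1
    have := Nat.le_of_dvd (hpos m) (h1.dvd_of_pow_eq_one _ h2)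
    exact absurd this (not_le.2 (Nat.pow_lt_pow_right hp.out.one_lt (Nat.lt_succ_self m)))

/-- The `p`-th power of the norm of a unit `f(ζ)` of `ℚ_p(ζ)`, with `ζ` a primitive
`p ^ (m + 1)`-th root of unity, is congruent to `1` modulo `p ^ (m + 2)`. -/
lemma norm_prod_primitiveRoots_pow_sub_one_le (m : ℕ) {f : ℤ_[p][X]} (hf : IsUnit (f.eval 1)) :
    ‖(∏ η ∈ primitiveRoots (p ^ (m + 1)) (PadicAlgCl p), aeval η f) ^ p - 1‖
      ≤ ‖(p : PadicAlgCl p)‖ * ‖((p ^ (m + 1) : ℕ) : PadicAlgCl p)‖ := by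
  have hpos (k : ℕ) : 0 < p ^ k := pow_pos hp.out.pos k
  obtain ⟨h, hh⟩ := exists_pow_eq_expand_add f
  have hf' : IsUnit ((expand ℤ_[p] p f).eval 1) := by rwa [expand_eval, one_pow]
  obtain ⟨u, v, huv⟩ := isCoprime_X_pow_sub_one (m + 1) hf'
  obtain ⟨u', v', huv'⟩ := isCoprime_X_pow_sub_one m hf
  have key (η) (hη : η ∈ nthRootsFinset (p ^ (m + 1)) (1 : PadicAlgCl p)) :
      aeval η f ^ p = aeval (η ^ p) f * (1 + p * aeval η (u * h)) := by
    rw [mem_nthRootsFinset (hpos _)] at hη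
    have h1 := congrArg (aeval η) hh
    have h2 := congrArg (aeval η) huv
    simp only [map_mul, map_add, map_pow, map_sub, map_one, aeval_X, hη, sub_self, mul_zero,
      add_zero, expand_aeval, map_natCast] at h1 h2
    rw [h1, map_mul]
    linear_combination (-p * aeval η h) * h2
  have hne : ∏ η ∈ nthRootsFinset (p ^ m) (1 : PadicAlgCl p), aeval η f ≠ 0 := by
    refine Finset.prod_ne_zero_iff.2 fun η hη h0 => ?_
    rw [mem_nthRootsFinset (hpos _)] at hη
    have h2 := congrArg (aeval η) huv'
    simp [hη, h0] at h2
  have hprod := Finset.prod_congr rfl key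
  rw [Finset.prod_mul_distrib, prod_nthRoots_comp_pow m (fun η => aeval η f), Finset.prod_pow,
    prod_nthRoots_eq_mul, mul_pow, mul_comm] at hprod
  rw [mul_left_cancel₀ (pow_ne_zero p hne) hprod]
  exact norm_prod_nthRoots_one_add_sub_one_le (hpos _) _

lemma norm_prod_primitiveRoots_one_add_sub_one_le (m : ℕ) (g : ℤ_[p][X]) :
    ‖∏ η ∈ primitiveRoots (p ^ (m + 1)) (PadicAlgCl p), (1 + p * (η ^ p ^ m - 1) * aeval η g) - 1‖
      ≤ ‖(p : PadicAlgCl p)‖ * ‖((p ^ (m + 1) : ℕ) : PadicAlgCl p)‖ := by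
  have hpos (k : ℕ) : 0 < p ^ k := pow_pos hp.out.pos k
  have h := norm_prod_nthRoots_one_add_sub_one_le (hpos (m + 1)) ((X ^ p ^ m - 1) * g)
  simp only [map_mul, map_sub, map_pow, map_one, aeval_X, ← mul_assoc] at h
  rw [prod_nthRoots_eq_mul] at h
  rwa [Finset.prod_eq_one (s := nthRootsFinset (p ^ m) (1 : PadicAlgCl p)), mul_one] at h
  intro η hη
  rw [mem_nthRootsFinset (hpos _)] at hη
  rw [hη, sub_self, mul_zero, zero_mul, add_zero]

lemma cyclotomic_comp_isEisensteinAt (m : ℕ) :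
    ((cyclotomic (p ^ (m + 1)) ℤ_[p]).comp (X + 1)).IsEisensteinAt
      (Submodule.span ℤ_[p] {(p : ℤ_[p])}) := by
  have hE := cyclotomic_prime_pow_comp_X_add_one_isEisensteinAt p m
  have hmap : (cyclotomic (p ^ (m + 1)) ℤ_[p]).comp (X + 1)
      = ((cyclotomic (p ^ (m + 1)) ℤ).comp (X + 1)).map (Int.castRingHom ℤ_[p]) := by
    rw [Polynomial.map_comp, map_cyclotomic]; simp
  have hmonic : ((cyclotomic (p ^ (m + 1)) ℤ).comp (X + 1)).Monic :=
    (cyclotomic.monic _ ℤ).comp (monic_X_add_C 1) (by rw [← C_1, natDegree_X_add_C]; exact one_ne_zero)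
  have hpprime := PadicInt.prime_p (p := p)
  refine Monic.isEisensteinAt_of_mem_of_notMem ?_ ?_ (fun {n} hn => ?_) ?_
  · rw [hmap]; exact hmonic.map _
  · exact Ideal.IsPrime.ne_top ((Ideal.span_singleton_prime hpprime.ne_zero).2 hpprime)
  · rw [hmap, hmonic.natDegree_map] at hn
    rw [hmap, coeff_map]
    have := hE.mem hn
    rw [Ideal.submodule_span_eq, Ideal.mem_span_singleton] at this ⊢
    obtain ⟨c, hc⟩ := this
    exact ⟨c, by rw [hc]; simp⟩
  · rw [coeff_zero_eq_eval_zero, eval_comp]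
    simp only [eval_add, eval_X, eval_one, zero_add, eval_one_cyclotomic_prime_pow]
    rw [Ideal.submodule_span_eq, Ideal.span_singleton_pow, Ideal.mem_span_singleton]
    rintro ⟨c, hc⟩
    refine hpprime.not_isUnit (IsUnit.of_mul_eq_one c ?_)
    refine mul_left_cancel₀ hpprime.ne_zero ?_
    rw [mul_one]
    linear_combination -hc

lemma irreducible_cyclotomic_padic (m : ℕ) : Irreducible (cyclotomic (p ^ (m + 1)) ℚ_[p]) := by
  have hpprime := PadicInt.prime_p (p := p)
  have hmonic : ((cyclotomic (p ^ (m + 1)) ℤ_[p]).comp (X + 1)).Monic :=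
    (cyclotomic.monic _ _).comp (monic_X_add_C 1) (by rw [← C_1, natDegree_X_add_C]; exact one_ne_zero)
  have hdeg : 0 < ((cyclotomic (p ^ (m + 1)) ℤ_[p]).comp (X + 1)).natDegree := by
    rw [natDegree_comp, ← C_1, natDegree_X_add_C, mul_one, natDegree_cyclotomic]
    exact Nat.totient_pos.2 (pow_pos hp.out.pos _)
  have h := (cyclotomic_comp_isEisensteinAt (p := p) m).irreducible
    ((Ideal.span_singleton_prime hpprime.ne_zero).2 hpprime) hmonic.isPrimitive hdeg
  have h' : Irreducible (cyclotomic (p ^ (m + 1)) ℤ_[p]) := by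
    rw [← MulEquiv.irreducible_iff (algEquivAevalXAddC (1 : ℤ_[p]))]
    simpa [comp, aeval_def] using h
  rw [← map_cyclotomic _ (algebraMap ℤ_[p] ℚ_[p])]
  exact ((cyclotomic.monic _ _).irreducible_iff_irreducible_map_fraction_map).1 h'

lemma isTorsionFree_padicInt (F : Type) [Field F] [Algebra ℚ_[p] F] :
    Module.IsTorsionFree ℤ_[p] F := by
  rw [Module.isTorsionFree_iff_algebraMap_injective]
  exact (algebraMap ℚ_[p] F).injective.comp (IsFractionRing.injective ℤ_[p] ℚ_[p])

lemma norm_mul_sub_one_le {a b : PadicAlgCl p} {C : ℝ} (hC : C ≤ 1) (ha : ‖a - 1‖ ≤ C)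
    (hb : ‖b - 1‖ ≤ C) : ‖a * b - 1‖ ≤ C := by
  have hb1 : ‖b‖ ≤ 1 := by
    have h := IsUltrametricDist.norm_add_le_max (b - 1) 1
    rw [sub_add_cancel, norm_one] at h
    exact h.trans (max_le (hb.trans hC) le_rfl)
  have : a * b - 1 = (a - 1) * b + (b - 1) := by ring
  rw [this]
  refine (IsUltrametricDist.norm_add_le_max _ _).trans (max_le ?_ hb)
  rw [norm_mul]
  exact (mul_le_of_le_one_right (norm_nonneg _) hb1).trans ha

section Cyclotomic

variable {F : Type} [Field F] [Algebra ℚ_[p] F] {m : ℕ} {ζ : F}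

lemma minpoly_padicInt_eq_cyclotomic (hζ : IsPrimitiveRoot ζ (p ^ (m + 1))) :
    minpoly ℤ_[p] ζ = cyclotomic (p ^ (m + 1)) ℤ_[p] := by
  have : NeZero ((p ^ (m + 1) : ℕ) : ℚ_[p]) := ⟨by exact_mod_cast pow_ne_zero _ hp.out.ne_zero⟩
  have hint : IsIntegral ℤ_[p] ζ := hζ.isIntegral (pow_pos hp.out.pos _) |>.tower_top
  apply map_injective _ (IsFractionRing.injective ℤ_[p] ℚ_[p])
  rw [← minpoly.isIntegrallyClosed_eq_field_fractions' ℚ_[p] hint, map_cyclotomic,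
    ← hζ.minpoly_eq_cyclotomic_of_irreducible (irreducible_cyclotomic_padic m)]

lemma exists_pow_smul_mem_adjoin (x : F) (g : ℚ_[p][X]) :
    ∃ n : ℕ, (p : ℤ_[p]) ^ n • aeval x g ∈ Algebra.adjoin ℤ_[p] {x} := by
  induction g using Polynomial.induction_on' with
  | add g h hg hh =>
    obtain ⟨a, ha⟩ := hg
    obtain ⟨b, hb⟩ := hh
    refine ⟨a + b, ?_⟩
    rw [map_add, smul_add]
    refine add_mem ?_ ?_
    · rw [pow_add, mul_comm, mul_smul]
      exact Subalgebra.smul_mem _ ha _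
    · rw [pow_add, mul_smul]
      exact Subalgebra.smul_mem _ hb _
  | monomial k a =>
    obtain ⟨⟨c, s, hs⟩, hc⟩ := IsLocalization.surj (nonZeroDivisors ℤ_[p]) a
    have hs0 : s ≠ 0 := nonZeroDivisors.ne_zero hs
    obtain ⟨n, u, hu⟩ : ∃ (n : ℕ) (u : ℤ_[p]ˣ), s = u * p ^ n :=
      ⟨_, _, PadicInt.unitCoeff_spec hs0⟩
    refine ⟨n, ?_⟩
    have : (p : ℤ_[p]) ^ n • aeval x (monomial k a) = ((u⁻¹ : ℤ_[p]ˣ) * c : ℤ_[p]) • x ^ k := by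
      rw [aeval_monomial, Algebra.smul_def, Algebra.smul_def, ← mul_assoc]
      congr 1
      rw [IsScalarTower.algebraMap_apply ℤ_[p] ℚ_[p] F, IsScalarTower.algebraMap_apply ℤ_[p] ℚ_[p] F,
        ← map_mul]
      congr 1
      dsimp only at hc
      rw [map_mul, ← hc, mul_comm a, ← mul_assoc]
      congr 1
      rw [← map_mul, hu, ← mul_assoc, Units.inv_mul, one_mul]
    rw [this]
    exact Subalgebra.smul_mem _ (pow_mem (Algebra.self_mem_adjoin_singleton _ _) _) _

lemma isUnit_eval_one (hζ : IsPrimitiveRoot ζ (p ^ (m + 1))) {f g : ℤ_[p][X]}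
    (h : aeval ζ f * aeval ζ g = 1) : IsUnit (f.eval 1) := by
  have hint : IsIntegral ℤ_[p] ζ := hζ.isIntegral (pow_pos hp.out.pos _) |>.tower_top
  have := isTorsionFree_padicInt (p := p) F
  have hd : minpoly ℤ_[p] ζ ∣ f * g - 1 :=
    minpoly.isIntegrallyClosed_dvd hint (by rw [map_sub, map_mul, h, map_one, sub_self])
  rw [minpoly_padicInt_eq_cyclotomic hζ] at hd
  obtain ⟨c, hc⟩ := hd
  have h1 := congrArg (eval 1) hc
  simp only [eval_sub, eval_mul, eval_one, eval_one_cyclotomic_prime_pow] at h1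
  by_contra hu
  have hf : f.eval 1 ∈ IsLocalRing.maximalIdeal ℤ_[p] := hu
  have hp' : (p : ℤ_[p]) ∈ IsLocalRing.maximalIdeal ℤ_[p] := by
    rw [PadicInt.maximalIdeal_eq_span_p]
    exact Ideal.mem_span_singleton_self _
  have : (1 : ℤ_[p]) ∈ IsLocalRing.maximalIdeal ℤ_[p] := by
    have := Ideal.sub_mem _ (Ideal.mul_mem_right (g.eval 1) _ hf)
      (Ideal.mul_mem_right (c.eval 1) _ hp')
    rwa [← h1, sub_sub_cancel] at this
  exact (IsLocalRing.maximalIdeal.isMaximal ℤ_[p]).ne_top ((Ideal.eq_top_iff_one _).2 this)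

variable [IsCyclotomicExtension {p ^ (m + 1)} ℚ_[p] F]

/-- The ring of integers of `ℚ_p(ζ)` is `ℤ_p[ζ]`. -/
lemma exists_aeval_eq_of_isIntegral (hζ : IsPrimitiveRoot ζ (p ^ (m + 1))) {z : F}
    (hz : IsIntegral ℤ_[p] z) : ∃ f : ℤ_[p][X], aeval ζ f = z := by
  have : NeZero (p ^ (m + 1)) := ⟨pow_ne_zero _ hp.out.ne_zero⟩
  have hint : IsIntegral ℤ_[p] ζ := hζ.isIntegral (pow_pos hp.out.pos _) |>.tower_top
  let B := hζ.subOnePowerBasis ℚ_[p]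
  have hgen : B.gen = ζ - 1 := hζ.subOnePowerBasis_gen ℚ_[p]
  have hBint : IsIntegral ℤ_[p] B.gen := by
    rw [hgen]; exact hint.sub isIntegral_one
  have hmin : (minpoly ℤ_[p] B.gen).IsEisensteinAt (Submodule.span ℤ_[p] {(p : ℤ_[p])}) := by
    have : minpoly ℤ_[p] B.gen = (cyclotomic (p ^ (m + 1)) ℤ_[p]).comp (X + 1) := by
      have h := minpoly.sub_algebraMap (A := ℚ_[p]) (B := F) (x := ζ) 1
      rw [map_one, ← hgen] at h
      apply map_injective _ (IsFractionRing.injective ℤ_[p] ℚ_[p])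
      rw [← minpoly.isIntegrallyClosed_eq_field_fractions' ℚ_[p] hBint, Polynomial.map_comp,
        map_cyclotomic, h, minpoly.isIntegrallyClosed_eq_field_fractions' ℚ_[p] hint,
        minpoly_padicInt_eq_cyclotomic hζ, map_cyclotomic]
      simp
    rw [this]
    exact cyclotomic_comp_isEisensteinAt m
  obtain ⟨g, hg⟩ : ∃ g : ℚ_[p][X], aeval B.gen g = z := by
    obtain ⟨g, -, hg⟩ := B.exists_eq_aeval z
    exact ⟨g, hg.symm⟩
  obtain ⟨n, hn⟩ := exists_pow_smul_mem_adjoin B.gen g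
  rw [hg] at hn
  have hmem := mem_adjoin_of_smul_prime_pow_smul_of_minpoly_isEisensteinAt
    (PadicInt.prime_p (p := p)) hBint hz hn hmin
  rw [Algebra.adjoin_singleton_eq_range_aeval] at hmem
  obtain ⟨f, hf⟩ := hmem
  refine ⟨f.comp (X - 1), ?_⟩
  rw [aeval_comp, map_sub, aeval_X, map_one, ← hgen]
  exact hf

lemma norm_aeval_eq_prod_primitiveRoots [FiniteDimensional ℚ_[p] F]
    (hζ : IsPrimitiveRoot ζ (p ^ (m + 1))) (f : ℤ_[p][X]) :
    algebraMap ℚ_[p] (PadicAlgCl p) (Algebra.norm ℚ_[p] (aeval ζ f))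
      = ∏ η ∈ primitiveRoots (p ^ (m + 1)) (PadicAlgCl p), aeval η f := by
  have : NeZero (p ^ (m + 1)) := ⟨pow_ne_zero _ hp.out.ne_zero⟩
  rw [Algebra.norm_eq_prod_embeddings ℚ_[p] (PadicAlgCl p),
    ← Finset.prod_coe_sort (primitiveRoots (p ^ (m + 1)) (PadicAlgCl p))]
  refine Fintype.prod_equiv (hζ.embeddingsEquivPrimitiveRoots (PadicAlgCl p)
    (irreducible_cyclotomic_padic m)) _
    (fun η : primitiveRoots (p ^ (m + 1)) (PadicAlgCl p) => aeval (η : PadicAlgCl p) f) fun σ => ?_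
  rw [hζ.embeddingsEquivPrimitiveRoots_apply_coe]
  exact (aeval_algHom_apply (σ.restrictScalars ℤ_[p]) ζ f).symm

/-- The congruence for `ℚ_p(ζ)`, with `ζ` a primitive `p ^ (m + 1)`-th root of unity. -/
lemma norm_norm_sub_one_le_of_cyclotomic [FiniteDimensional ℚ_[p] F]
    (hζ : IsPrimitiveRoot ζ (p ^ (m + 1))) {w w' y : F} (hw : IsIntegral ℤ_[p] w)
    (hw' : IsIntegral ℤ_[p] w') (hww' : w * w' = 1) (hy : IsIntegral ℤ_[p] y) :
    ‖Algebra.norm ℚ_[p] (w ^ p * (1 + p * (ζ ^ p ^ m - 1) * y)) - 1‖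
      ≤ ‖(p : ℚ_[p])‖ ^ (m + 2) := by
  obtain ⟨f, rfl⟩ := exists_aeval_eq_of_isIntegral hζ hw
  obtain ⟨f', rfl⟩ := exists_aeval_eq_of_isIntegral hζ hw'
  obtain ⟨g, rfl⟩ := exists_aeval_eq_of_isIntegral hζ hy
  have hy' : 1 + p * (ζ ^ p ^ m - 1) * aeval ζ g
      = aeval ζ (1 + (p : ℤ_[p][X]) * (X ^ p ^ m - 1) * g) := by simp
  have hC : ‖(p : PadicAlgCl p)‖ * ‖((p ^ (m + 1) : ℕ) : PadicAlgCl p)‖ = ‖(p : ℚ_[p])‖ ^ (m + 2) := by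
    rw [norm_natCast_padicAlgCl, norm_natCast_padicAlgCl]
    push_cast
    rw [norm_pow]; ring
  have hC1 : ‖(p : ℚ_[p])‖ ^ (m + 2) ≤ 1 :=
    pow_le_one₀ (norm_nonneg _) Padic.norm_p_lt_one.le
  rw [← PadicAlgCl.norm_extends]
  simp only [map_sub, map_one]
  rw [map_mul, map_pow, map_mul, map_pow, hy', norm_aeval_eq_prod_primitiveRoots hζ,
    norm_aeval_eq_prod_primitiveRoots hζ]
  refine norm_mul_sub_one_le hC1 ?_ ?_
  · rw [← hC]
    exact norm_prod_primitiveRoots_pow_sub_one_le m (isUnit_eval_one hζ hww')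
  · rw [← hC]
    simpa using norm_prod_primitiveRoots_one_add_sub_one_le m g

end Cyclotomic

lemma exists_prod_one_add_mul_eq {σ R S : Type*} [CommRing R] [CommRing S] [Algebra R S]
    (s : Finset σ) {c : S} (hc : IsIntegral R c) (a : σ → S)
    (ha : ∀ i ∈ s, IsIntegral R (a i)) :
    ∃ b, IsIntegral R b ∧ ∏ i ∈ s, (1 + c * a i) = 1 + c * b := by
  classical
  induction s using Finset.induction_on with
  | empty => exact ⟨0, isIntegral_zero, by simp⟩
  | insert i s hi ih =>
    obtain ⟨b, hb, h⟩ := ih fun j hj => ha j (Finset.mem_insert_of_mem hj)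
    have hai := ha i (Finset.mem_insert_self _ _)
    refine ⟨a i + b + c * a i * b, ?_, ?_⟩
    · exact (hai.add hb).add ((hc.mul hai).mul hb)
    · rw [Finset.prod_insert hi, h]; ring

/-- The relative norm of `1 + c y` has the form `1 + c y'`. -/
lemma exists_norm_one_add_mul_eq {F K : Type} [Field F] [Field K] [Algebra ℚ_[p] F]
    [Algebra ℚ_[p] K] [Algebra F K] [IsScalarTower ℚ_[p] F K] [FiniteDimensional ℚ_[p] K]
    {c : F} (hc : IsIntegral ℤ_[p] c) {y : K} (hy : IsIntegral ℤ_[p] y) :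
    ∃ y' : F, IsIntegral ℤ_[p] y' ∧ Algebra.norm F (1 + algebraMap F K c * y) = 1 + c * y' := by
  rcases eq_or_ne c 0 with rfl | hc0
  · exact ⟨0, isIntegral_zero, by simp⟩
  have : FiniteDimensional F K := FiniteDimensional.right ℚ_[p] F K
  have : CharZero F := charZero_of_injective_algebraMap (algebraMap ℚ_[p] F).injective
  let E := AlgebraicClosure F
  have hmap : Function.Injective (algebraMap F E) := (algebraMap F E).injective
  have hcE : IsIntegral ℤ_[p] (algebraMap F E c) := hc.map (IsScalarTower.toAlgHom ℤ_[p] F E)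
  obtain ⟨b, hb, h⟩ := exists_prod_one_add_mul_eq (univ : Finset (K →ₐ[F] E)) hcE (fun σ => σ y)
    fun σ _ => hy.map (σ.restrictScalars ℤ_[p])
  have hN : algebraMap F E (Algebra.norm F (1 + algebraMap F K c * y))
      = 1 + algebraMap F E c * b := by
    rw [Algebra.norm_eq_prod_embeddings F E, ← h]
    simp
  refine ⟨(Algebra.norm F (1 + algebraMap F K c * y) - 1) / c, ?_, ?_⟩
  · rw [← isIntegral_algHom_iff (IsScalarTower.toAlgHom ℤ_[p] F E) hmap]
    have : (IsScalarTower.toAlgHom ℤ_[p] F E)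
        ((Algebra.norm F (1 + algebraMap F K c * y) - 1) / c) = b := by
      rw [IsScalarTower.coe_toAlgHom', map_div₀, map_sub, hN, map_one, add_sub_cancel_left,
        mul_div_cancel_left₀]
      exact (_root_.map_ne_zero _).2 hc0
    rwa [this]
  · rw [mul_div_cancel₀ _ hc0, add_sub_cancel]

/-- The congruence for a unit of the form `x ^ p (1 + p λ y)`, where `λ = ζ_p - 1`. -/
lemma norm_norm_sub_one_le {K : Type} [Field K] [Algebra ℚ_[p] K] [FiniteDimensional ℚ_[p] K]
    {m : ℕ} {ζ : K} (hζ : IsPrimitiveRoot ζ (p ^ (m + 1))) {x x' y : K}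
    (hx : IsIntegral ℤ_[p] x) (hx' : IsIntegral ℤ_[p] x') (hxx' : x * x' = 1)
    (hy : IsIntegral ℤ_[p] y) :
    ‖Algebra.norm ℚ_[p] (x ^ p * (1 + p * (ζ ^ p ^ m - 1) * y)) - 1‖
      ≤ ‖(p : ℚ_[p])‖ ^ (m + 2) := by
  have : NeZero (p ^ (m + 1)) := ⟨pow_ne_zero _ hp.out.ne_zero⟩
  let F := IntermediateField.adjoin ℚ_[p] {ζ}
  have : IsCyclotomicExtension {p ^ (m + 1)} ℚ_[p] F :=
    hζ.intermediateField_adjoin_isCyclotomicExtension ℚ_[p]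
  let z : F := ⟨ζ, IntermediateField.mem_adjoin_simple_self _ _⟩
  have hz : IsPrimitiveRoot z (p ^ (m + 1)) :=
    IsPrimitiveRoot.of_map_of_injective (f := algebraMap F K) hζ (algebraMap F K).injective
  have hzint : IsIntegral ℤ_[p] z := hz.isIntegral (pow_pos hp.out.pos _) |>.tower_top
  have hc : IsIntegral ℤ_[p] ((p : F) * (z ^ p ^ m - 1)) := by
    refine IsIntegral.mul ?_ ((hzint.pow _).sub isIntegral_one)
    simpa using isIntegral_algebraMap (R := ℤ_[p]) (A := F) (x := (p : ℤ_[p]))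
  obtain ⟨y', hy', h⟩ := exists_norm_one_add_mul_eq (K := K) hc hy
  have hcK : algebraMap F K ((p : F) * (z ^ p ^ m - 1)) = p * (ζ ^ p ^ m - 1) := by
    rw [map_mul, map_sub, map_pow, map_natCast, map_one]; rfl
  have : FiniteDimensional F K := FiniteDimensional.right ℚ_[p] F K
  have : CharZero F := charZero_of_injective_algebraMap (algebraMap ℚ_[p] F).injective
  rw [hcK] at h
  rw [← Algebra.norm_norm (S := F), map_mul, map_pow, h]
  exact norm_norm_sub_one_le_of_cyclotomic hz (Algebra.isIntegral_norm F hx)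
    (Algebra.isIntegral_norm F hx') (by rw [← map_mul, hxx', map_one]) hy'

section Trace

attribute [local instance] Ideal.Quotient.field

/-- If the residue ring of `S` over the maximal ideal `P` of `R` is a finite separable field
extension of `R ⧸ P`, then the trace of `S` over `R` takes a value outside `P`. -/
lemma exists_intTrace_notMem {R S : Type*} [CommRing R] [CommRing S] [Algebra R S]
    [IsDedekindDomain R] [IsDomain S] [Module.IsTorsionFree R S] [Module.Finite R S]
    [IsIntegrallyClosed S] (P : Ideal R) [P.IsMaximal] [Finite (R ⧸ P)]
    (hmax : (P.map (algebraMap R S)).IsMaximal) : ∃ t : S, Algebra.intTrace R S t ∉ P := by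
  have : Module.Finite (R ⧸ P) (S ⧸ P.map (algebraMap R S)) :=
    Module.Finite.of_restrictScalars_finite R _ _
  obtain ⟨t', ht'⟩ := Algebra.trace_surjective (R ⧸ P) (S ⧸ P.map (algebraMap R S)) 1
  obtain ⟨t, rfl⟩ := Ideal.Quotient.mk_surjective t'
  refine ⟨t, fun h => one_ne_zero (α := R ⧸ P) ?_⟩
  rw [← ht']
  refine (Algebra.trace_quotient_eq_of_isDedekindDomain S P t).trans ?_
  exact Ideal.Quotient.eq_zero_iff_mem.2 h

end Trace

section Ring

variable (K : Type) [Field K] [Algebra ℚ_[p] K]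

lemma isUnit_iff_norm_eq_one (ι : K →ₐ[ℚ_[p]] PadicAlgCl p) (x : O p K) :
    IsUnit x ↔ ‖ι x‖ = 1 := by
  have hle (y : O p K) : ‖ι y‖ ≤ 1 := (isIntegral_iff_norm_le_one ι (y : K)).1 y.2
  constructor
  · rintro ⟨u, rfl⟩
    have h : ‖ι (u : O p K)‖ * ‖ι (↑u⁻¹ : O p K)‖ = 1 := by
      rw [← norm_mul, ← map_mul, ← Subalgebra.coe_mul, Units.mul_inv, Subalgebra.coe_one, map_one,
        norm_one]
    refine le_antisymm (hle _) ?_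
    rw [← h]
    exact mul_le_of_le_one_right (norm_nonneg _) (hle _)
  · intro h
    have h0 : (x : K) ≠ 0 := by
      rintro h0
      rw [h0, map_zero, norm_zero] at h
      exact zero_ne_one h
    have hinv : IsIntegral ℤ_[p] (x : K)⁻¹ := by
      rw [isIntegral_iff_norm_le_one ι, map_inv₀, norm_inv, h, inv_one]
    exact IsUnit.of_mul_eq_one ⟨(x : K)⁻¹, hinv⟩ (Subtype.ext (mul_inv_cancel₀ h0))

variable [FiniteDimensional ℚ_[p] K]

instance : IsDedekindDomain (O p K) := integralClosure.isDedekindDomain ℤ_[p] ℚ_[p] K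

instance : IsFractionRing (O p K) K :=
  IsIntegralClosure.isFractionRing_of_finite_extension ℤ_[p] ℚ_[p] K (O p K)

instance : Module.Finite ℤ_[p] (O p K) := IsIntegralClosure.finite ℤ_[p] ℚ_[p] K (O p K)

instance : IsLocalRing (O p K) := by
  let ι : K →ₐ[ℚ_[p]] PadicAlgCl p := IsAlgClosed.lift
  refine IsLocalRing.of_nonunits_add fun a b ha hb => ?_
  have hlt {y : O p K} : y ∈ nonunits (O p K) ↔ ‖ι y‖ < 1 := by
    rw [mem_nonunits_iff, isUnit_iff_norm_eq_one K ι]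
    exact ((isIntegral_iff_norm_le_one ι (y : K)).1 y.2).lt_iff_ne.symm
  rw [hlt] at ha hb ⊢
  rw [Subalgebra.coe_add, map_add]
  exact (IsUltrametricDist.norm_add_le_max _ _).trans_lt (max_lt ha hb)

lemma maxIdeal_eq_maximalIdeal : maxIdeal p K = IsLocalRing.maximalIdeal (O p K) :=
  IsLocalRing.jacobson_eq_maximalIdeal _ bot_ne_top

instance : Finite (O p K ⧸ IsLocalRing.maximalIdeal (O p K)) := by
  have : Finite (IsLocalRing.ResidueField ℤ_[p]) :=
    Finite.of_equiv _ PadicInt.residueField.symm.toEquiv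
  exact Module.finite_of_finite (IsLocalRing.ResidueField ℤ_[p])
    (M := IsLocalRing.ResidueField (O p K))

end Ring

lemma exists_trace_eq_one {K L : Type} [Field K] [Field L] [Algebra ℚ_[p] K] [Algebra ℚ_[p] L]
    [Algebra K L] [IsScalarTower ℚ_[p] K L] [FiniteDimensional ℚ_[p] K] [FiniteDimensional ℚ_[p] L]
    (h : IsUnramifiedExt p K L) : ∃ t : L, IsIntegral ℤ_[p] t ∧ Algebra.trace K L t = 1 := by
  let : Algebra (O p K) (O p L) := (intMap p K L).toAlgebra
  have : IsScalarTower (O p K) (O p L) L := .of_algebraMap_eq fun _ => rfl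
  have : IsScalarTower ℤ_[p] (O p K) (O p L) := .of_algebraMap_eq fun x =>
    Subtype.ext (IsScalarTower.algebraMap_apply ℤ_[p] K L x)
  have : Module.Finite (O p K) (O p L) := .of_restrictScalars_finite ℤ_[p] _ _
  have : FiniteDimensional K L := .right ℚ_[p] K L
  have : Module.IsTorsionFree (O p K) (O p L) := by
    rw [Module.isTorsionFree_iff_algebraMap_injective]
    exact fun x y hxy => Subtype.ext ((algebraMap K L).injective (congrArg Subtype.val hxy))
  have : CharZero K := charZero_of_injective_algebraMap (algebraMap ℚ_[p] K).injective
  rw [IsUnramifiedExt, maxIdeal_eq_maximalIdeal, maxIdeal_eq_maximalIdeal] at h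
  obtain ⟨t, ht⟩ := exists_intTrace_notMem (S := O p L) (IsLocalRing.maximalIdeal (O p K))
    (h ▸ IsLocalRing.maximalIdeal.isMaximal (O p L))
  rw [IsLocalRing.notMem_maximalIdeal] at ht
  obtain ⟨u, hu⟩ := ht
  refine ⟨((↑u⁻¹ : O p K) • t : O p L), Subtype.property _, ?_⟩
  have := Algebra.algebraMap_intTrace (A := O p K) (B := O p L) (K := K) (L := L)
    ((↑u⁻¹ : O p K) • t)
  rw [map_smul, ← hu, smul_eq_mul, Units.inv_mul, map_one] at this
  exact this.symm

lemma exists_pow_prime_eq_of_one_add_pow_eq_one {A : Type*} [CommRing A] {l : A}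
    (hl : (1 + l) ^ p = 1) : ∃ r, l ^ p = p * l * r := by
  obtain ⟨r, hr⟩ := exists_add_pow_prime_eq hp.out 1 l
  exact ⟨-r, by rw [hl, one_pow] at hr; linear_combination -hr⟩

lemma exists_one_add_mul_pow_eq {A : Type*} [CommRing A] {l : A} (hl : (1 + l) ^ p = 1) (c : A) :
    ∃ d, (1 + l * c) ^ p = 1 + p * l * d := by
  obtain ⟨r, hr⟩ := exists_pow_prime_eq_of_one_add_pow_eq_one hl
  obtain ⟨s, hs⟩ := exists_add_pow_prime_eq hp.out 1 (l * c)
  exact ⟨r * c ^ p + c * s, by rw [hs, one_pow, mul_pow, hr]; ring⟩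

lemma norm_lt_one_of_one_add_pow_eq_one {l : PadicAlgCl p} (hl : (1 + l) ^ p = 1) : ‖l‖ < 1 := by
  have h1 : ‖1 + l‖ ≤ 1 := by
    have : ‖1 + l‖ ^ p = 1 := by rw [← norm_pow, hl, norm_one]
    exact ((pow_eq_one_iff_of_nonneg (norm_nonneg _) hp.out.ne_zero).1 this).le
  have hl1 : IsIntegral ℤ_[p] l := by
    have := (isIntegral_of_norm_le_one h1).sub (isIntegral_one (R := ℤ_[p]))
    rwa [add_sub_cancel_left] at this
  obtain ⟨r, hr⟩ := exists_pow_prime_eq_of_one_add_pow_eq_one (p := p)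
    (l := (⟨l, hl1⟩ : integralClosure ℤ_[p] (PadicAlgCl p))) (Subtype.ext hl)
  have hr' : l ^ p = p * l * r := by simpa using congrArg Subtype.val hr
  by_contra! hge
  have hp1 : ‖(p : PadicAlgCl p)‖ < 1 := by
    rw [norm_natCast_padicAlgCl]; exact Padic.norm_p_lt_one
  have h : ‖l‖ ^ p < ‖l‖ := by
    rw [← norm_pow, hr', norm_mul, norm_mul]
    calc _ ≤ ‖(p : PadicAlgCl p)‖ * ‖l‖ * 1 := by
          gcongr; exact norm_le_one_of_isIntegral r.2
      _ < 1 * ‖l‖ := by rw [mul_one]; gcongr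
      _ = ‖l‖ := one_mul _
  exact h.not_ge (le_self_pow₀ hge hp.out.ne_zero)

lemma norm_one_add_eq_one {x : PadicAlgCl p} (hx : ‖x‖ < 1) : ‖1 + x‖ = 1 := by
  rw [IsUltrametricDist.norm_add_eq_max_of_norm_ne_norm (by rw [norm_one]; exact hx.ne'), norm_one,
    max_eq_left hx.le]

/-- The `p`-th power of the inverse of `1 + l c` is `1 + p l d`. -/
lemma exists_inv_one_add_mul_pow_eq {l c : PadicAlgCl p} (hl : (1 + l) ^ p = 1) (hc : ‖c‖ ≤ 1) :
    ‖1 + l * c‖ = 1 ∧ ∃ d, ‖d‖ ≤ 1 ∧ (1 + l * c)⁻¹ ^ p = 1 + p * l * d := by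
  have hl1 := norm_lt_one_of_one_add_pow_eq_one hl
  have hn : ‖1 + l * c‖ = 1 := norm_one_add_eq_one <| by
    rw [norm_mul]
    exact (mul_le_of_le_one_right (norm_nonneg _) hc).trans_lt hl1
  refine ⟨hn, ?_⟩
  have h0 : 1 + l * c ≠ 0 := norm_ne_zero_iff.1 (by rw [hn]; exact one_ne_zero)
  have hinv : (1 + l * c)⁻¹ = 1 + l * (-c * (1 + l * c)⁻¹) := by
    field_simp
    ring
  have hc' : ‖-c * (1 + l * c)⁻¹‖ ≤ 1 := by rwa [norm_mul, norm_neg, norm_inv, hn, inv_one, mul_one]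
  obtain ⟨d, hd⟩ := exists_one_add_mul_pow_eq (p := p)
    (l := (⟨l, isIntegral_of_norm_le_one hl1.le⟩ : integralClosure ℤ_[p] (PadicAlgCl p)))
    (Subtype.ext hl) ⟨_, isIntegral_of_norm_le_one hc'⟩
  refine ⟨d, norm_le_one_of_isIntegral d.2, ?_⟩
  rw [hinv]
  simpa using congrArg Subtype.val hd

lemma exists_eq_mul_one_add {ω a b : PadicAlgCl p} (hω : IsPrimitiveRoot ω p) (hb : b ≠ 0)
    (h : a ^ p = b ^ p) : ∃ c, ‖c‖ ≤ 1 ∧ a = b * (1 + (ω - 1) * c) := by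
  obtain ⟨i, -, hi⟩ := hω.eq_pow_of_pow_eq_one (ξ := a / b)
    (by rw [div_pow, h, div_self (pow_ne_zero _ hb)])
  have hω1 : ‖ω‖ = 1 := by
    rw [← pow_eq_one_iff_of_nonneg (norm_nonneg _) hp.out.ne_zero, ← norm_pow, hω.pow_eq_one,
      norm_one]
  refine ⟨∑ j ∈ range i, ω ^ j, norm_sum_le_of_forall _ _ zero_le_one fun j _ => ?_, ?_⟩
  · rw [norm_pow, hω1, one_pow]
  · rw [mul_geom_sum, add_sub_cancel, hi, mul_div_cancel₀ _ hb]

/-- A unit which becomes a `p`-th power in an unramified extension is, up to a `p`-th power of a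
unit, congruent to `1` modulo `p (ω - 1)`. -/
lemma exists_eq_pow_mul_one_add {K L : Type} [Field K] [Field L] [Algebra ℚ_[p] K]
    [Algebra ℚ_[p] L] [Algebra K L] [IsScalarTower ℚ_[p] K L] [FiniteDimensional ℚ_[p] K]
    [FiniteDimensional ℚ_[p] L] (hunr : IsUnramifiedExt p K L) {ω : K} (hω : IsPrimitiveRoot ω p)
    {α : K} (hα : IsIntegralUnit p K α) {β : L} (hβ : β ^ p = algebraMap K L α) :
    ∃ x x' y : K, IsIntegral ℤ_[p] x ∧ IsIntegral ℤ_[p] x' ∧ x * x' = 1 ∧ IsIntegral ℤ_[p] y ∧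
      α = x ^ p * (1 + p * (ω - 1) * y) := by
  obtain ⟨t, ht, htr⟩ := exists_trace_eq_one hunr
  let ι : K →ₐ[ℚ_[p]] PadicAlgCl p := IsAlgClosed.lift
  let : Algebra K (PadicAlgCl p) := ι.toRingHom.toAlgebra
  have hι : ⇑(algebraMap K (PadicAlgCl p)) = ι := rfl
  have : IsScalarTower ℚ_[p] K (PadicAlgCl p) := .of_algebraMap_eq fun x => (ι.commutes x).symm
  have : FiniteDimensional K L := .right ℚ_[p] K L
  have : CharZero K := charZero_of_injective_algebraMap (algebraMap ℚ_[p] K).injective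
  have hιω : IsPrimitiveRoot (ι ω) p := hω.map_of_injective ι.injective
  obtain ⟨u, rfl⟩ := hα
  set α : K := ((u : O p K) : K)
  have hια : ‖ι α‖ = 1 := (isUnit_iff_norm_eq_one K ι _).1 u.isUnit
  have hpow (τ : L →ₐ[K] PadicAlgCl p) : τ β ^ p = ι α := by
    rw [← map_pow, hβ, AlgHom.commutes, hι]
  let τ₀ : L →ₐ[K] PadicAlgCl p := IsAlgClosed.lift
  set b := τ₀ β
  have hb : ‖b‖ = 1 := by
    rw [← pow_eq_one_iff_of_nonneg (norm_nonneg _) hp.out.ne_zero, ← norm_pow, hpow, hια]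
  have hb0 : b ≠ 0 := norm_ne_zero_iff.1 (by rw [hb]; exact one_ne_zero)
  choose c hc hcb using fun τ : L →ₐ[K] PadicAlgCl p =>
    exists_eq_mul_one_add hιω hb0 ((hpow τ).trans (hpow τ₀).symm)
  have hnt (τ : L →ₐ[K] PadicAlgCl p) : ‖τ t‖ ≤ 1 :=
    (isIntegral_iff_norm_le_one (τ.restrictScalars ℚ_[p]) t).1 ht
  set C := ∑ τ : L →ₐ[K] PadicAlgCl p, τ t * c τ
  have hC : ‖C‖ ≤ 1 := norm_sum_le_of_forall _ _ zero_le_one fun τ _ => by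
    rw [norm_mul]; exact mul_le_one₀ (hnt τ) (norm_nonneg _) (hc τ)
  set x := Algebra.trace K L (t * β)
  have hx : ι x = b * (1 + (ι ω - 1) * C) := by
    have h1 : ∑ τ : L →ₐ[K] PadicAlgCl p, τ t = 1 := by
      rw [← trace_eq_sum_embeddings (K := K), htr, map_one]
    have h2 : b * (1 + (ι ω - 1) * C) = b * (∑ τ : L →ₐ[K] PadicAlgCl p, τ t + (ι ω - 1) * C) := by
      rw [h1]
    rw [← hι, trace_eq_sum_embeddings, hι, h2, Finset.mul_sum, ← Finset.sum_add_distrib,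
      Finset.mul_sum]
    refine Finset.sum_congr rfl fun τ _ => ?_
    rw [map_mul]
    rw [hcb τ]
    ring
  have hl : (1 + (ι ω - 1)) ^ p = 1 := by rw [add_sub_cancel, hιω.pow_eq_one]
  obtain ⟨hn, d, hd, hdeq⟩ := exists_inv_one_add_mul_pow_eq hl hC
  have hnx : ‖ι x‖ = 1 := by rw [hx, norm_mul, hb, hn, one_mul]
  have hx0 : x ≠ 0 := by
    intro h
    rw [h, map_zero, norm_zero] at hnx
    exact zero_ne_one hnx
  have hpl : (p : K) * (ω - 1) ≠ 0 := mul_ne_zero (Nat.cast_ne_zero.2 hp.out.ne_zero)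
    (sub_ne_zero.2 (hω.ne_one hp.out.one_lt))
  refine ⟨x, x⁻¹, (α / x ^ p - 1) / (p * (ω - 1)), ?_, ?_, mul_inv_cancel₀ hx0, ?_, ?_⟩
  · rw [isIntegral_iff_norm_le_one ι, hnx]
  · rw [isIntegral_iff_norm_le_one ι, map_inv₀, norm_inv, hnx, inv_one]
  · rw [isIntegral_iff_norm_le_one ι]
    have hq : ι (α / x ^ p) = 1 + p * (ι ω - 1) * d := by
      rw [map_div₀, map_pow, hx, ← hpow τ₀, ← hdeq, mul_pow, inv_pow, div_mul_eq_div_div,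
        div_self (pow_ne_zero _ hb0), one_div]
    have hpl' : (p : PadicAlgCl p) * (ι ω - 1) ≠ 0 := by
      simpa using (_root_.map_ne_zero ι).2 hpl
    rw [map_div₀, map_sub, hq, map_one, add_sub_cancel_left, map_mul, map_natCast, map_sub,
      map_one, mul_div_cancel_left₀ _ hpl']
    exact hd
  · rw [mul_div_cancel₀ _ hpl, add_sub_cancel, mul_div_cancel₀ _ (pow_ne_zero _ hx0)]

end PadicStmt

open PadicStmt in
/-- Let `p` be a prime and `K` a finite extension of `ℚ_p` containing a
primitive `p^m`-th root of unity, `m ≥ 1`.  If `α` is a `p`-primary unit of `K`, then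
`N_{K/ℚ_p}(α) ≡ 1 (mod p^{m+1})`. -/
theorem stmt0 (p : ℕ) [Fact p.Prime] (K : Type) [Field K] [Algebra ℚ_[p] K]
    [FiniteDimensional ℚ_[p] K] (m : ℕ) (hm : 1 ≤ m)
    (ζ : K) (hζ : IsPrimitiveRoot ζ (p ^ m))
    (α : K) (hα : IsPPrimary p K α) :
    ‖Algebra.norm ℚ_[p] α - 1‖ ≤ (p : ℝ) ^ (-((m : ℤ) + 1)) := by
  obtain ⟨m, rfl⟩ := Nat.exists_eq_add_of_le' hm
  obtain ⟨hu, ⟨L, β, hβ, hunr⟩⟩ := hα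
  have hω : IsPrimitiveRoot (ζ ^ p ^ m) p :=
    hζ.pow (pow_pos (Fact.out : p.Prime).pos _) (pow_succ p m)
  obtain ⟨x, x', y, hx, hx', hxx', hy, rfl⟩ := exists_eq_pow_mul_one_add hunr hω hu hβ
  refine (norm_norm_sub_one_le hζ hx hx' hxx' hy).trans_eq ?_
  rw [Padic.norm_p, inv_pow, ← zpow_natCast, ← zpow_neg]
  congr 1
end
end

section
/- Let p be a prime and let E/F be a finite unramified extension of p-adic fields (finite extensions of ℚ_p) such that F contains a primitive p-th root of unity. If α ∈ O_E^× is a p-primary unit of E, then N_{E/F}(α) is a p-primary unit of F. -/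
set_option synthInstance.maxHeartbeats 1000000
set_option maxHeartbeats 1000000
noncomputable section

section AdicCompleteness

/-- A finite module over an `I`-adically precomplete ring is `I`-adically precomplete. -/
theorem isPrecomplete_of_finite {R : Type*} [CommRing R] (I : Ideal R) [IsPrecomplete I R]
    (M : Type*) [AddCommGroup M] [Module R M] [Module.Finite R M] : IsPrecomplete I M := by
  rw [← AdicCompletion.of_surjective_iff]
  intro y
  obtain ⟨n, f, hf⟩ := Module.Finite.exists_fin' R M
  obtain ⟨x, rfl⟩ := AdicCompletion.map_surjective I hf y
  choose z hz using fun i => AdicCompletion.of_surjective I R (AdicCompletion.piEquivFin I n x i)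
  refine ⟨f z, ?_⟩
  rw [← AdicCompletion.map_of]
  congr 1
  apply (AdicCompletion.piEquivFin I n).injective
  funext i
  rw [← hz i]
  rfl

theorem isAdicComplete_of_finite {R : Type*} [CommRing R] [IsNoetherianRing R] (I : Ideal R)
    [IsAdicComplete I R] (M : Type*) [AddCommGroup M] [Module R M] [Module.Finite R M] :
    IsAdicComplete I M where
  toIsHausdorff := IsHausdorff.of_le_jacobson I M (IsAdicComplete.le_jacobson_bot I)
  toIsPrecomplete := isPrecomplete_of_finite I M

end AdicCompleteness

section Teichmuller

/-- Some positive iterate of the `p`-th power map of a finite commutative ring is idempotent. -/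
theorem exists_pow_pow_eq_of_finite (p : ℕ) (A : Type*) [CommRing A] [Finite A] :
    ∃ k : ℕ, 0 < k ∧ ∀ a : A, (a ^ p ^ k) ^ p ^ k = a ^ p ^ k := by
  obtain ⟨i, j, hij, h⟩ : ∃ i j : ℕ, i < j ∧ ∀ a : A, a ^ p ^ i = a ^ p ^ j := by
    obtain ⟨i, j, hne, h⟩ :=
      Finite.exists_ne_map_eq_of_infinite fun (n : ℕ) (a : A) => a ^ p ^ n
    rcases hne.lt_or_gt with hlt | hlt
    · exact ⟨i, j, hlt, congrFun h⟩
    · exact ⟨j, i, hlt, fun a => (congrFun h a).symm⟩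
  obtain ⟨d, rfl⟩ := Nat.exists_eq_add_of_lt hij
  have step (n m : ℕ) (hn : i ≤ n) (a : A) : a ^ p ^ (n + (d + 1) * m) = a ^ p ^ n := by
    induction m with
    | zero => simp
    | succ m ih =>
      obtain ⟨e, rfl⟩ := Nat.exists_eq_add_of_le hn
      rw [← ih, show i + e + (d + 1) * (m + 1) = (i + d + 1) + (e + (d + 1) * m) by ring,
        pow_add, pow_mul, ← h, ← pow_mul, ← pow_add, ← add_assoc]
  refine ⟨(d + 1) * (i + 1), by positivity, fun a => ?_⟩
  rw [← pow_mul, ← pow_add]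
  exact step _ _ (by nlinarith) a

open Polynomial in
/-- Teichmüller representatives modulo the Jacobson radical of a `p`-adically complete ring. -/
theorem exists_teichmuller (p : ℕ) [Fact p.Prime] (R : Type*) [CommRing R] [Nontrivial R]
    [IsAdicComplete (Ideal.span {(p : R)}) R] [Finite (R ⧸ Ideal.span {(p : R)})] :
    ∃ q : ℕ, 1 < q ∧ ∀ a : R, ∃ t : R, t ^ q = t ∧ a - t ∈ (⊥ : Ideal R).jacobson := by
  set I := Ideal.span {(p : R)}
  have hI : I ≤ (⊥ : Ideal R).jacobson := IsAdicComplete.le_jacobson_bot I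
  have hpI : (p : R) ∈ I := Ideal.mem_span_singleton_self _
  have hp : (p : R) ∈ nonunits R := fun hu => by
    have := Ideal.eq_top_of_isUnit_mem _ (hI hpI) hu
    rw [Ideal.jacobson_eq_top_iff] at this
    exact bot_ne_top this
  have : CharP (R ⧸ I) p := CharP.quotient R p hp
  obtain ⟨k, hk, hfrob⟩ := exists_pow_pow_eq_of_finite p (R ⧸ I)
  have hq : 1 < p ^ k := Nat.one_lt_pow hk.ne' (Fact.out : p.Prime).one_lt
  refine ⟨p ^ k, hq, fun a => ?_⟩
  have hb : a ^ p ^ k - a ∈ (⊥ : Ideal R).jacobson := by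
    refine (Ideal.isRadical_jacobson (⊥ : Ideal R)) ⟨p ^ k, hI ?_⟩
    rw [← Ideal.Quotient.eq_zero_iff_mem, map_pow, map_sub, sub_pow_char_pow, map_pow, hfrob,
      sub_self]
  obtain ⟨t, ht, hta⟩ := HenselianRing.is_henselian (I := I) (X ^ p ^ k - X : R[X])
    (monic_X_pow_sub (by rw [degree_X]; exact_mod_cast hq)) (a ^ p ^ k)
    (by
      rw [← Ideal.Quotient.eq_zero_iff_mem]
      simp [hfrob])
    (by simp [derivative_X_pow, hk.ne'])
  refine ⟨t, by simpa [sub_eq_zero] using ht, ?_⟩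
  have := add_mem hb (hI hta)
  rw [← neg_mem_iff]
  convert this using 1
  ring

end Teichmuller

section Normality

open Polynomial in
/-- A field extension generated by solutions of `x ^ q = x` is normal. -/
theorem normal_of_adjoin_pow_eq_self {F L : Type*} [Field F] [Field L] [Algebra F L] {q : ℕ}
    (hq : 1 < q) (h : IntermediateField.adjoin F {x : L | x ^ q = x} = ⊤) : Normal F L := by
  have key : ∀ x ∈ {x : L | x ^ q = x},
      IsIntegral F x ∧ ((minpoly F x).map (algebraMap F L)).Splits := by
    intro x hx
    rcases eq_or_ne x 0 with rfl | hx0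
    · exact ⟨isIntegral_zero, by simp⟩
    have h1 : x ^ (q - 1) = 1 := by
      apply mul_right_cancel₀ hx0
      rw [← pow_succ, Nat.sub_add_cancel hq.le, one_mul]
      exact hx
    have hpos : 0 < orderOf x :=
      orderOf_pos_iff.2 (isOfFinOrder_iff_pow_eq_one.2 ⟨q - 1, Nat.sub_pos_of_lt hq, h1⟩)
    have hprim := IsPrimitiveRoot.orderOf x
    refine ⟨hprim.isIntegral hpos |>.tower_top, ?_⟩
    have hs : (X ^ orderOf x - 1 : L[X]).Splits := X_pow_sub_one_splits hprim
    refine hs.of_dvd (X_pow_sub_C_ne_zero hpos 1) ?_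
    have hd : minpoly F x ∣ X ^ orderOf x - 1 := minpoly.dvd F x (by simp [pow_orderOf_eq_one])
    simpa using Polynomial.map_dvd (algebraMap F L) hd
  have hmem (x : L) : x ∈ IntermediateField.adjoin F {x : L | x ^ q = x} :=
    h ▸ IntermediateField.mem_top
  have hint : Algebra.IsAlgebraic F L := by
    have := IntermediateField.isAlgebraic_adjoin (K := F) fun x hx => (key x hx).1
    exact ⟨fun x => by
      simpa using! (Algebra.IsAlgebraic.isAlgebraic (R := F)
        (⟨x, hmem x⟩ : IntermediateField.adjoin F {x : L | x ^ q = x})).algebraMap (A := L)⟩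
  exact normal_iff.2 fun x =>
    ⟨(hint.isAlgebraic x).isIntegral, IntermediateField.splits_of_mem_adjoin F L key (hmem x)⟩

end Normality

namespace PadicStmt

variable (p : ℕ) [Fact p.Prime]

instance finite_integers (K : Type) [Field K] [Algebra ℚ_[p] K] [FiniteDimensional ℚ_[p] K] :
    Module.Finite ℤ_[p] (O p K) :=
  IsIntegralClosure.finite ℤ_[p] ℚ_[p] K (O p K)

theorem span_natCast_eq_map (R : Type*) [CommRing R] [Algebra ℤ_[p] R] :
    Ideal.span {(p : R)} =
      (IsLocalRing.maximalIdeal ℤ_[p]).map (algebraMap ℤ_[p] R) := by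
  rw [PadicInt.maximalIdeal_eq_span_p, Ideal.map_span, Set.image_singleton, map_natCast]

theorem isAdicComplete_span_natCast (R : Type*) [CommRing R] [Algebra ℤ_[p] R]
    [Module.Finite ℤ_[p] R] : IsAdicComplete (Ideal.span {(p : R)}) R := by
  rw [span_natCast_eq_map, IsAdicComplete.map_algebraMap_iff]
  exact isAdicComplete_of_finite _ R

theorem finite_quotient_span_natCast (R : Type*) [CommRing R] [Algebra ℤ_[p] R]
    [Module.Finite ℤ_[p] R] : Finite (R ⧸ Ideal.span {(p : R)}) := by
  have : Finite (ℤ_[p] ⧸ IsLocalRing.maximalIdeal ℤ_[p]) :=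
    Finite.of_equiv _ (PadicInt.residueField (p := p)).symm.toEquiv
  have : Finite (R ⧸ (⊤ : Submodule ℤ_[p] R)) := inferInstance
  have h := Submodule.finite_quotient_smul (IsLocalRing.maximalIdeal ℤ_[p])
    (N := (⊤ : Submodule ℤ_[p] R)) Module.Finite.fg_top
  rw [Ideal.smul_top_eq_map, ← span_natCast_eq_map] at h
  exact h

/-- An unramified extension of `p`-adic fields is normal. -/
theorem IsUnramifiedExt.normal {F L : Type} [Field F] [Field L] [Algebra ℚ_[p] F]
    [Algebra ℚ_[p] L] [Algebra F L] [IsScalarTower ℚ_[p] F L] [FiniteDimensional ℚ_[p] L]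
    (h : IsUnramifiedExt p F L) : Normal F L := by
  have := isAdicComplete_span_natCast p (O p L)
  have := finite_quotient_span_natCast p (O p L)
  obtain ⟨q, hq, ht⟩ := exists_teichmuller p (O p L)
  apply normal_of_adjoin_pow_eq_self hq
  set S := IntermediateField.adjoin F {x : L | x ^ q = x}
  let : Algebra (O p F) (O p L) := (intMap p F L).toAlgebra
  have : IsScalarTower ℤ_[p] (O p F) (O p L) := IsScalarTower.of_algebraMap_eq fun x =>
    Subtype.ext (IsScalarTower.algebraMap_apply ℤ_[p] F L x)
  have : Module.Finite (O p F) (O p L) := Module.Finite.of_restrictScalars_finite ℤ_[p] _ _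
  let N : Submodule (O p F) (O p L) :=
    { carrier := {r | (r : L) ∈ S}
      add_mem' := fun ha hb => S.add_mem ha hb
      zero_mem' := S.zero_mem
      smul_mem' := fun c x hx => by
        rw [Algebra.smul_def]
        exact S.mul_mem (S.algebraMap_mem (c : F)) hx }
  have hN : (⊤ : Submodule (O p F) (O p L)) ≤ N := by
    refine Submodule.le_of_le_smul_of_le_jacobson_bot (I := maxIdeal p F)
      Module.Finite.fg_top le_rfl fun a _ => ?_
    obtain ⟨t, htq, hta⟩ := ht a
    rw [← add_sub_cancel t a]
    refine Submodule.add_mem_sup ?_ ?_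
    · exact IntermediateField.subset_adjoin F _ (congrArg Subtype.val htq)
    · rw [Ideal.smul_top_eq_map]
      change a - t ∈ Ideal.map (intMap p F L) (maxIdeal p F)
      rw [h]
      exact hta
  rw [eq_top_iff]
  intro y _
  have : IsFractionRing (O p L) L :=
    integralClosure.isFractionRing_of_finite_extension ℚ_[p] L
  obtain ⟨a, b, -, rfl⟩ := IsFractionRing.div_surjective (A := O p L) y
  exact S.div_mem (hN (Submodule.mem_top (x := a))) (hN (Submodule.mem_top (x := b)))

theorem IsUnramifiedExt.trans {F E L : Type} [Field F] [Field E] [Field L] [Algebra ℚ_[p] F]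
    [Algebra ℚ_[p] E] [Algebra ℚ_[p] L] [Algebra F E] [Algebra E L] [Algebra F L]
    [IsScalarTower ℚ_[p] F E] [IsScalarTower ℚ_[p] E L] [IsScalarTower ℚ_[p] F L]
    [IsScalarTower F E L] (hFE : IsUnramifiedExt p F E) (hEL : IsUnramifiedExt p E L) :
    IsUnramifiedExt p F L := by
  have hcomp : intMap p F L = (intMap p E L).comp (intMap p F E) :=
    RingHom.ext fun x => Subtype.ext (IsScalarTower.algebraMap_apply F E L x.1)
  rw [IsUnramifiedExt, hcomp, ← Ideal.map_map, hFE, hEL]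

theorem IsIntegralUnit.norm {F E : Type} [Field F] [Field E] [Algebra ℚ_[p] F]
    [Algebra ℚ_[p] E] [Algebra F E] [IsScalarTower ℚ_[p] F E] [FiniteDimensional F E]
    {α : E} (hα : IsIntegralUnit p E α) : IsIntegralUnit p F (Algebra.norm F α) := by
  obtain ⟨u, rfl⟩ := hα
  have hint (x : O p E) : IsIntegral ℤ_[p] (Algebra.norm F (x : E)) :=
    Algebra.isIntegral_norm F x.2
  have hmul : Algebra.norm F ((u : O p E) : E) *
      Algebra.norm F (((u⁻¹ : (O p E)ˣ) : O p E) : E) = 1 := by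
    rw [← map_mul, ← Subalgebra.coe_mul, Units.mul_inv, Subalgebra.coe_one, map_one]
  exact ⟨⟨⟨_, hint u⟩, ⟨_, hint (u⁻¹ : (O p E)ˣ)⟩, Subtype.ext hmul,
    Subtype.ext ((mul_comm _ _).trans hmul)⟩, rfl⟩

end PadicStmt

/-- If `α ∈ E` becomes an `n`-th power in a normal extension `L` of `F`, where `E/F` is Galois,
then so does its norm down to `F`. -/
theorem exists_pow_eq_norm {F E L : Type*} [Field F] [Field E] [Field L] [Algebra F E]
    [Algebra E L] [Algebra F L] [IsScalarTower F E L] [FiniteDimensional F E] [IsGalois F E]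
    [Normal F L] {n : ℕ} {α : E} {β : L} (h : β ^ n = algebraMap E L α) :
    ∃ γ : L, γ ^ n = algebraMap F L (Algebra.norm F α) := by
  refine ⟨∏ σ : Gal(E/F), σ.liftNormal L β, ?_⟩
  rw [IsScalarTower.algebraMap_apply F E L, Algebra.norm_eq_prod_automorphisms, map_prod,
    ← Finset.prod_pow]
  refine Finset.prod_congr rfl fun σ _ => ?_
  rw [← map_pow, h, AlgEquiv.liftNormal_commutes]

open PadicStmt in
/-- Let `E/F` be a finite *unramified* extension of `p`-adic fields such
that `F` contains a primitive `p`-th root of unity.  If `α` is a `p`-primary unit of `E`,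
then `N_{E/F}(α)` is a `p`-primary unit of `F`. -/
theorem stmt8 (p : ℕ) [Fact p.Prime] (F E : Type) [Field F] [Field E]
    [Algebra ℚ_[p] F] [Algebra ℚ_[p] E] [Algebra F E] [IsScalarTower ℚ_[p] F E]
    [FiniteDimensional ℚ_[p] F] [FiniteDimensional ℚ_[p] E]
    (hur : IsUnramifiedExt p F E)
    (ζ : F) (hζ : IsPrimitiveRoot ζ p)
    (α : E) (hα : IsPPrimary p E α) :
    IsPPrimary p F (Algebra.norm F α) := by
  have : FiniteDimensional F E := FiniteDimensional.right ℚ_[p] F E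
  obtain ⟨hunit, ⟨w⟩⟩ := hα
  refine ⟨IsIntegralUnit.norm p hunit, ?_⟩
  obtain @⟨L, _, _, _, _, _, β, hβ, hL⟩ := w
  let : Algebra F L := ((algebraMap E L).comp (algebraMap F E)).toAlgebra
  have : IsScalarTower F E L := IsScalarTower.of_algebraMap_eq fun _ => rfl
  have : IsScalarTower ℚ_[p] F L := IsScalarTower.of_algebraMap_eq fun x => by
    rw [IsScalarTower.algebraMap_apply F E L, ← IsScalarTower.algebraMap_apply ℚ_[p] F E,
      ← IsScalarTower.algebraMap_apply ℚ_[p] E L]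
  have hFL : IsUnramifiedExt p F L := IsUnramifiedExt.trans p hur hL
  have : CharZero F := charZero_of_injective_algebraMap (algebraMap ℚ_[p] F).injective
  have : Normal F E := IsUnramifiedExt.normal p hur
  have : Normal F L := IsUnramifiedExt.normal p hFL
  have : IsGalois F E := {}
  obtain ⟨γ, hγ⟩ := exists_pow_eq_norm (F := F) hβ
  exact ⟨{ L := L, β := γ, pow_eq := hγ, unram := hFL }⟩
end
end
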